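/- Under the exclusion restrictions of the instrumental-variable model, the conditional-centering projection of the unrestricted Y-component of the efficient influence curve onto the restricted-model tangent space equals the restricted Y-component: for every ω ∈ Ω, E[D_Y | Y=Y(ω), M=M(ω), Z=Z(ω), W=W(ω), S=S(ω)] − E[D_Y | M=M(ω), Z=Z(ω), W=W(ω), S=S(ω)] = D_{Y,r}(ω). -/

import Mathlib

open MeasureTheory

noncomputable section

/-- Discrete transported-mediation setup: a probability space `(Ω, P)` carrying
binary random variables `S, A, Z, M`, a covariate `W` valued in a nonempty finite
set `𝒲`, and an outcome `Y` valued in a nonempty finite set `ySet ⊆ ℝ`, with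
strong positivity of every joint cell. -/
structure TransportSetup (Ω : Type*) [MeasurableSpace Ω]
    (𝒲 : Type*) [MeasurableSpace 𝒲] [MeasurableSingletonClass 𝒲]
    [Fintype 𝒲] [Nonempty 𝒲] where
  P : Measure Ω
  isProb : IsProbabilityMeasure P
  S : Ω → Fin 2
  A : Ω → Fin 2
  Z : Ω → Fin 2
  M : Ω → Fin 2
  W : Ω → 𝒲
  Y : Ω → ℝ
  ySet : Finset ℝ
  ySet_nonempty : ySet.Nonempty
  hY : ∀ ω, Y ω ∈ ySet
  measS : Measurable S
  measA : Measurable A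
  measZ : Measurable Z
  measM : Measurable M
  measW : Measurable W
  measY : Measurable Y
  positivity : ∀ (s' x z m : Fin 2) (w : 𝒲), ∀ y ∈ ySet,
    0 < P {ω | S ω = s' ∧ W ω = w ∧ A ω = x ∧ Z ω = z ∧ M ω = m ∧ Y ω = y}

namespace TransportSetup

variable {Ω : Type*} [MeasurableSpace Ω]
  {𝒲 : Type*} [MeasurableSpace 𝒲] [MeasurableSingletonClass 𝒲]
  [Fintype 𝒲] [Nonempty 𝒲]
variable (T : TransportSetup Ω 𝒲)

/-- Probability of an event, as a real number. -/
def pr (E : Set Ω) : ℝ := (T.P E).toReal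

/-- Conditional probability `P(E | F)`. -/
def cpr (E F : Set Ω) : ℝ := T.pr (E ∩ F) / T.pr F

/-- Conditional expectation `E[f | F]` of a real random variable given an event. -/
def cexp (f : Ω → ℝ) (F : Set Ω) : ℝ := (∫ ω in F, f ω ∂T.P) / T.pr F

/-- `Q̄_Y(m,z,x,w) = E[Y | M=m, Z=z, A=x, W=w, S=1]`. -/
def qbarY (m z x : Fin 2) (w : 𝒲) : ℝ :=
  T.cexp T.Y {ω | T.M ω = m ∧ T.Z ω = z ∧ T.A ω = x ∧ T.W ω = w ∧ T.S ω = 1}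

/-- `P(Z=z | A=x, W=w, S=s)`. -/
def pZ (x z : Fin 2) (w : 𝒲) (s : Fin 2) : ℝ :=
  T.cpr {ω | T.Z ω = z} {ω | T.A ω = x ∧ T.W ω = w ∧ T.S ω = s}

/-- `P(S=s | W=w)`. -/
def pSW (s : Fin 2) (w : 𝒲) : ℝ := T.cpr {ω | T.S ω = s} {ω | T.W ω = w}

/-- `P(M=m | Z=z, A=x, W=w, S=1)`. -/
def pM (m z x : Fin 2) (w : 𝒲) : ℝ :=
  T.cpr {ω | T.M ω = m} {ω | T.Z ω = z ∧ T.A ω = x ∧ T.W ω = w ∧ T.S ω = 1}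

/-- `P(A=x | W=w, S=s)`. -/
def pA (x : Fin 2) (w : 𝒲) (s : Fin 2) : ℝ :=
  T.cpr {ω | T.A ω = x} {ω | T.W ω = w ∧ T.S ω = s}

/-- `P(S=0)`. -/
def pS0 : ℝ := T.pr {ω | T.S ω = 0}

/-- `P(W=w | S=0)`. -/
def pWS0 (w : 𝒲) : ℝ := T.cpr {ω | T.W ω = w} {ω | T.S ω = 0}

/-- The transported estimand `Ψ(P)`. -/
def Psi (gs : Fin 2 → 𝒲 → ℝ) (a : Fin 2) : ℝ :=
  ∑ w : 𝒲, ∑ z : Fin 2, ∑ m : Fin 2,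
    T.pWS0 w * T.pZ a z w 0 * gs m w * T.qbarY m z a w

/-- The transport-mediation weight `H`. -/
def Hwt (gs : Fin 2 → 𝒲 → ℝ) (a : Fin 2) (ω : Ω) : ℝ :=
  (gs (T.M ω) (T.W ω) * T.pZ a (T.Z ω) (T.W ω) 0 * T.pSW 0 (T.W ω) *
    (if T.S ω = 1 ∧ T.A ω = a then (1 : ℝ) else 0)) /
  (T.pM (T.M ω) (T.Z ω) a (T.W ω) * T.pZ a (T.Z ω) (T.W ω) 1 * T.pA a (T.W ω) 1 *
    T.pSW 1 (T.W ω) * T.pS0)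

/-- `Q̄_M(z,x,w) = Σ_m g*(m|w) Q̄_Y(m,z,x,w)`. -/
def qbarM (gs : Fin 2 → 𝒲 → ℝ) (z x : Fin 2) (w : 𝒲) : ℝ :=
  ∑ m : Fin 2, gs m w * T.qbarY m z x w

/-- `Q̄_Z(w) = Σ_z P(Z=z|A=a,W=w,S=0) Q̄_M(z,a,w)`. -/
def qbarZ (gs : Fin 2 → 𝒲 → ℝ) (a : Fin 2) (w : 𝒲) : ℝ :=
  ∑ z : Fin 2, T.pZ a z w 0 * T.qbarM gs z a w

/-- `D_Y`, the `Y`-component of the (unrestricted-model) efficient influence curve. -/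
def DY (gs : Fin 2 → 𝒲 → ℝ) (a : Fin 2) (ω : Ω) : ℝ :=
  (T.Y ω - T.qbarY (T.M ω) (T.Z ω) (T.A ω) (T.W ω)) * T.Hwt gs a ω

/-- `D_Z`, the `Z`-component of the efficient influence curve. -/
def DZ (gs : Fin 2 → 𝒲 → ℝ) (a : Fin 2) (ω : Ω) : ℝ :=
  (T.qbarM gs (T.Z ω) a (T.W ω) - T.qbarZ gs a (T.W ω)) *
    (if T.S ω = 0 ∧ T.A ω = a then (1 : ℝ) else 0) / (T.pA a (T.W ω) 0 * T.pS0)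

/-- `D_W`, the `W`-component of the efficient influence curve. -/
def DW (gs : Fin 2 → 𝒲 → ℝ) (a : Fin 2) (ω : Ω) : ℝ :=
  (T.qbarZ gs a (T.W ω) - T.Psi gs a) *
    (if T.S ω = 0 then (1 : ℝ) else 0) / T.pS0


end TransportSetup

namespace TransportSetup

variable {Ω : Type*} [MeasurableSpace Ω]
  {𝒲 : Type*} [MeasurableSpace 𝒲] [MeasurableSingletonClass 𝒲]
  [Fintype 𝒲] [Nonempty 𝒲]
variable (T : TransportSetup Ω 𝒲)

/-- `Q̄_{Y,r}(m,z,w) = E[Y | M=m, Z=z, W=w]` (restricted model). -/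
def qbarYr (m z : Fin 2) (w : 𝒲) : ℝ :=
  T.cexp T.Y {ω | T.M ω = m ∧ T.Z ω = z ∧ T.W ω = w}

/-- `P(M=m | Z=z, W=w, S=1)` (restricted model). -/
def pMr (m z : Fin 2) (w : 𝒲) : ℝ :=
  T.cpr {ω | T.M ω = m} {ω | T.Z ω = z ∧ T.W ω = w ∧ T.S ω = 1}

/-- `P(Z=z | W=w, S=1) = Σ_x P(Z=z | A=x, W=w, S=1) · P(A=x | W=w, S=1)`. -/
def pZr (z : Fin 2) (w : 𝒲) : ℝ :=
  ∑ x : Fin 2, T.pZ x z w 1 * T.pA x w 1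

/-- `D_{Y,r}`, the `Y`-component of the efficient influence curve for the
restricted model in which `M` and `Y` do not depend directly on `A`. -/
def DYr (gs : Fin 2 → 𝒲 → ℝ) (a : Fin 2) (ω : Ω) : ℝ :=
  (T.Y ω - T.qbarYr (T.M ω) (T.Z ω) (T.W ω)) *
    ((gs (T.M ω) (T.W ω) * T.pZ a (T.Z ω) (T.W ω) 0 * T.pSW 0 (T.W ω) *
      (if T.S ω = 1 then (1 : ℝ) else 0)) /
    (T.pMr (T.M ω) (T.Z ω) (T.W ω) * T.pZr (T.Z ω) (T.W ω) *
      T.pSW 1 (T.W ω) * T.pS0))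

end TransportSetup

namespace TransportSetup

variable {Ω : Type*} [MeasurableSpace Ω]
  {𝒲 : Type*} [MeasurableSpace 𝒲] [MeasurableSingletonClass 𝒲]
  [Fintype 𝒲] [Nonempty 𝒲]
variable (T : TransportSetup Ω 𝒲)

theorem pr_split (f : Ω → Fin 2) (hf : Measurable f) (F : Set Ω) :
    T.pr F = T.pr (F ∩ {ω | f ω = 0}) + T.pr (F ∩ {ω | f ω = 1}) := by
  have := T.isProb
  have hm : MeasurableSet {ω | f ω = 0} := hf (measurableSet_singleton 0)
  unfold pr
  rw [← measure_inter_add_diff F hm, ENNReal.toReal_add (measure_ne_top _ _) (measure_ne_top _ _)]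
  congr 3
  ext ω
  simp only [Set.mem_diff, Set.mem_inter_iff, Set.mem_setOf_eq]
  have : f ω = 0 ∨ f ω = 1 := by omega
  constructor
  · rintro ⟨h1, h2⟩
    exact ⟨h1, by tauto⟩
  · rintro ⟨h1, h2⟩
    exact ⟨h1, by simp [h2]⟩

theorem pr_pos (F : Set Ω) (s x z m : Fin 2) (w : 𝒲)
    (h : {ω | T.S ω = s ∧ T.W ω = w ∧ T.A ω = x ∧ T.Z ω = z ∧ T.M ω = m} ⊆ F) : 0 < T.pr F := by
  have := T.isProb
  obtain ⟨y, hy⟩ := T.ySet_nonempty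
  refine ENNReal.toReal_pos ?_ (measure_ne_top _ _)
  refine ((T.positivity s x z m w y hy).trans_le (measure_mono (Set.Subset.trans ?_ h))).ne'
  intro ω hω
  simp only [Set.mem_setOf_eq] at hω ⊢
  tauto

theorem pr_pos_y (F : Set Ω) (s x z m : Fin 2) (w : 𝒲) (y : ℝ) (hy : y ∈ T.ySet)
    (h : {ω | T.S ω = s ∧ T.W ω = w ∧ T.A ω = x ∧ T.Z ω = z ∧ T.M ω = m ∧ T.Y ω = y} ⊆ F) :
    0 < T.pr F := by
  have := T.isProb
  refine ENNReal.toReal_pos ?_ (measure_ne_top _ _)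
  exact ((T.positivity s x z m w y hy).trans_le (measure_mono h)).ne'

theorem Y_integrable : Integrable T.Y T.P := by
  have := T.isProb
  refine Integrable.of_bound T.measY.aestronglyMeasurable (∑ y ∈ T.ySet, ‖y‖) ?_
  refine Filter.Eventually.of_forall fun ω => ?_
  exact Finset.single_le_sum (f := fun y : ℝ => ‖y‖) (fun _ _ => norm_nonneg _) (T.hY ω)

theorem integral_Y (F : Set Ω) :
    ∫ ω in F, T.Y ω ∂T.P = ∑ y ∈ T.ySet, y * T.pr ({ω | T.Y ω = y} ∩ F) := by
  have := T.isProb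
  have hm : ∀ y, MeasurableSet {ω | T.Y ω = y} := fun y => T.measY (measurableSet_singleton y)
  have h : ∀ ω, T.Y ω = ∑ y ∈ T.ySet, Set.indicator {ω | T.Y ω = y} (fun _ => y) ω := by
    intro ω
    simp only [Set.indicator_apply, Set.mem_setOf_eq]
    rw [Finset.sum_ite_eq, if_pos (T.hY ω)]
  rw [integral_congr_ae (Filter.Eventually.of_forall h), integral_finset_sum]
  · refine Finset.sum_congr rfl fun y _ => ?_
    rw [integral_indicator_const _ (hm y), measureReal_restrict_apply (hm y), smul_eq_mul, mul_comm]
    rfl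
  · intro y _
    exact (integrable_const y).indicator (hm y)

theorem cexp_Y (F : Set Ω) :
    T.cexp T.Y F = ∑ y ∈ T.ySet, y * T.cpr {ω | T.Y ω = y} F := by
  simp only [cexp, integral_Y, cpr, Finset.sum_div, mul_div_assoc]

/-- mixing -/
theorem cpr_mix (f : Ω → Fin 2) (hf : Measurable f) (E F : Set Ω) (K : ℝ)
    (hp : ∀ x, 0 < T.pr (F ∩ {ω | f ω = x}))
    (h : ∀ x, T.cpr E (F ∩ {ω | f ω = x}) = K) : T.cpr E F = K := by
  have h0 := h 0
  have h1 := h 1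
  have p0 := hp 0
  have p1 := hp 1
  unfold cpr at *
  rw [div_eq_iff p0.ne'] at h0
  rw [div_eq_iff p1.ne'] at h1
  have hF := T.pr_split f hf F
  have hE := T.pr_split f hf (E ∩ F)
  rw [Set.inter_assoc, Set.inter_assoc] at hE
  rw [div_eq_iff (by linarith), hE, h0, h1, hF]
  ring

theorem cpr_mix_A (hYexcl : ∀ (m z x x' s' s'' : Fin 2) (w : 𝒲) (y : ℝ), y ∈ T.ySet →
      T.cpr {ω | T.Y ω = y} {ω | T.M ω = m ∧ T.Z ω = z ∧ T.A ω = x ∧ T.W ω = w ∧ T.S ω = s'} =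
      T.cpr {ω | T.Y ω = y} {ω | T.M ω = m ∧ T.Z ω = z ∧ T.A ω = x' ∧ T.W ω = w ∧ T.S ω = s''})
    (a m z s : Fin 2) (w : 𝒲) (y : ℝ) (hy : y ∈ T.ySet) :
    T.cpr {ω | T.Y ω = y} {ω | T.M ω = m ∧ T.Z ω = z ∧ T.W ω = w ∧ T.S ω = s} =
    T.cpr {ω | T.Y ω = y} {ω | T.M ω = m ∧ T.Z ω = z ∧ T.A ω = a ∧ T.W ω = w ∧ T.S ω = 1} := by
  have e : ∀ x, {ω | T.M ω = m ∧ T.Z ω = z ∧ T.W ω = w ∧ T.S ω = s} ∩ {ω | T.A ω = x} =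
      {ω | T.M ω = m ∧ T.Z ω = z ∧ T.A ω = x ∧ T.W ω = w ∧ T.S ω = s} := by
    intro x
    ext ω
    simp only [Set.mem_inter_iff, Set.mem_setOf_eq]
    tauto
  refine T.cpr_mix T.A T.measA _ _ _ (fun x => ?_) (fun x => ?_)
  · refine T.pr_pos _ s x z m w fun ω hω => ?_
    simp only [Set.mem_inter_iff, Set.mem_setOf_eq] at hω ⊢
    tauto
  · rw [e x]
    exact hYexcl m z x a s 1 w y hy

theorem qbarYr_eq (hYexcl : ∀ (m z x x' s' s'' : Fin 2) (w : 𝒲) (y : ℝ), y ∈ T.ySet →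
      T.cpr {ω | T.Y ω = y} {ω | T.M ω = m ∧ T.Z ω = z ∧ T.A ω = x ∧ T.W ω = w ∧ T.S ω = s'} =
      T.cpr {ω | T.Y ω = y} {ω | T.M ω = m ∧ T.Z ω = z ∧ T.A ω = x' ∧ T.W ω = w ∧ T.S ω = s''})
    (a m z : Fin 2) (w : 𝒲) : T.qbarYr m z w = T.qbarY m z a w := by
  unfold qbarYr qbarY
  rw [cexp_Y, cexp_Y]
  refine Finset.sum_congr rfl fun y hy => ?_
  congr 1
  refine T.cpr_mix T.S T.measS _ _ _ (fun x => ?_) (fun x => ?_)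
  · refine T.pr_pos _ x 0 z m w fun ω hω => ?_
    simp only [Set.mem_inter_iff, Set.mem_setOf_eq] at hω ⊢
    tauto
  · rw [← T.cpr_mix_A hYexcl a m z x w y hy]
    congr 1
    ext ω
    simp only [Set.mem_inter_iff, Set.mem_setOf_eq]
    tauto

/-- the denominators -/
theorem denom_a (a m z : Fin 2) (w : 𝒲) :
    T.pM m z a w * T.pZ a z w 1 * T.pA a w 1 =
      T.pr {ω | T.M ω = m ∧ T.Z ω = z ∧ T.A ω = a ∧ T.W ω = w ∧ T.S ω = 1} /
        T.pr {ω | T.W ω = w ∧ T.S ω = 1} := by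
  unfold pM pZ pA cpr
  simp only [← Set.setOf_and]
  have h1 : 0 < T.pr {ω | T.Z ω = z ∧ T.A ω = a ∧ T.W ω = w ∧ T.S ω = 1} := by
    refine T.pr_pos _ 1 a z m w fun ω hω => ?_
    simp only [Set.mem_setOf_eq] at hω ⊢
    tauto
  have h2 : 0 < T.pr {ω | T.A ω = a ∧ T.W ω = w ∧ T.S ω = 1} := by
    refine T.pr_pos _ 1 a z m w fun ω hω => ?_
    simp only [Set.mem_setOf_eq] at hω ⊢
    tauto
  field_simp

theorem denom_r (m z : Fin 2) (w : 𝒲) :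
    T.pMr m z w * T.pZr z w =
      T.pr {ω | T.M ω = m ∧ T.Z ω = z ∧ T.W ω = w ∧ T.S ω = 1} /
        T.pr {ω | T.W ω = w ∧ T.S ω = 1} := by
  have h1 : 0 < T.pr {ω | T.Z ω = z ∧ T.W ω = w ∧ T.S ω = 1} := by
    refine T.pr_pos _ 1 0 z m w fun ω hω => ?_
    simp only [Set.mem_setOf_eq] at hω ⊢
    tauto
  have h2 : ∀ a, 0 < T.pr {ω | T.A ω = a ∧ T.W ω = w ∧ T.S ω = 1} := by
    intro a
    refine T.pr_pos _ 1 a z m w fun ω hω => ?_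
    simp only [Set.mem_setOf_eq] at hω ⊢
    tauto
  have h3 : ∀ x, T.pZ x z w 1 * T.pA x w 1 =
      T.pr ({ω | T.Z ω = z ∧ T.W ω = w ∧ T.S ω = 1} ∩ {ω | T.A ω = x}) /
        T.pr {ω | T.W ω = w ∧ T.S ω = 1} := by
    intro x
    have e : {ω | T.Z ω = z ∧ T.W ω = w ∧ T.S ω = 1} ∩ {ω | T.A ω = x} =
        {ω | T.Z ω = z ∧ T.A ω = x ∧ T.W ω = w ∧ T.S ω = 1} := by
      ext ω
      simp only [Set.mem_inter_iff, Set.mem_setOf_eq]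
      tauto
    rw [e]
    unfold pZ pA cpr
    simp only [← Set.setOf_and]
    have := h2 x
    field_simp
  unfold pZr
  rw [Fin.sum_univ_two, h3, h3, ← add_div, ← T.pr_split T.A T.measA]
  unfold pMr cpr
  simp only [← Set.setOf_and]
  field_simp

/-- the integral of `D_Y` over an event on which `M, Z, W, S` are fixed, `S = 1` -/
theorem integral_DY (gs : Fin 2 → 𝒲 → ℝ) (a m z : Fin 2) (w : 𝒲) (F : Set Ω)
    (hFm : MeasurableSet F)
    (hF : ∀ ω ∈ F, T.M ω = m ∧ T.Z ω = z ∧ T.W ω = w ∧ T.S ω = 1) :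
    ∫ ω in F, T.DY gs a ω ∂T.P =
      (gs m w * T.pZ a z w 0 * T.pSW 0 w /
        (T.pM m z a w * T.pZ a z w 1 * T.pA a w 1 * T.pSW 1 w * T.pS0)) *
      ((∫ ω in F ∩ {ω | T.A ω = a}, T.Y ω ∂T.P) -
        T.qbarY m z a w * T.pr (F ∩ {ω | T.A ω = a})) := by
  have := T.isProb
  have hm : MeasurableSet {ω | T.A ω = a} := T.measA (measurableSet_singleton a)
  set c := gs m w * T.pZ a z w 0 * T.pSW 0 w /
        (T.pM m z a w * T.pZ a z w 1 * T.pA a w 1 * T.pSW 1 w * T.pS0) with hc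
  have e : ∫ ω in F, T.DY gs a ω ∂T.P =
      ∫ ω in F, Set.indicator {ω | T.A ω = a} (fun ω => c * (T.Y ω - T.qbarY m z a w)) ω ∂T.P := by
    refine setIntegral_congr_fun hFm fun ω hω => ?_
    obtain ⟨h1, h2, h3, h4⟩ := hF ω hω
    by_cases hA : T.A ω = a
    · simp only [DY, Hwt, h1, h2, h3, h4, hA, Set.indicator_apply, Set.mem_setOf_eq, hc]
      simp only [and_self, if_true]
      ring
    · simp [DY, Hwt, hA, Set.indicator_apply]
  rw [e, setIntegral_indicator hm, integral_const_mul, integral_sub T.Y_integrable.integrableOn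
    (integrable_const _), setIntegral_const, smul_eq_mul, mul_comm (T.P.real _)]
  rfl

end TransportSetup

/-- Under the exclusion restrictions of the instrumental-variable
model, the conditional-centering projection of the unrestricted `Y`-component of the
efficient influence curve onto the restricted-model tangent space equals the
restricted `Y`-component: for every `ω`,
`E[D_Y | Y, M, Z, W, S] − E[D_Y | M, Z, W, S] = D_{Y,r}(ω)`. -/
theorem projection_of_DY_onto_restricted_tangent_space
    {Ω : Type*} [MeasurableSpace Ω]
    {𝒲 : Type*} [MeasurableSpace 𝒲] [MeasurableSingletonClass 𝒲]
    [Fintype 𝒲] [Nonempty 𝒲]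
    (T : TransportSetup Ω 𝒲) (a : Fin 2)
    (gs : Fin 2 → 𝒲 → ℝ)
    (hgs_pos : ∀ (m : Fin 2) (w : 𝒲), 0 < gs m w ∧ gs m w < 1)
    (hgs_sum : ∀ w : 𝒲, gs 0 w + gs 1 w = 1)
    -- exclusion restriction: `P(Y=y | M=m, Z=z, A=x, W=w, S=s')` does not depend on `x, s'`
    (hYexcl : ∀ (m z x x' s' s'' : Fin 2) (w : 𝒲) (y : ℝ), y ∈ T.ySet →
      T.cpr {ω | T.Y ω = y} {ω | T.M ω = m ∧ T.Z ω = z ∧ T.A ω = x ∧ T.W ω = w ∧ T.S ω = s'} =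
      T.cpr {ω | T.Y ω = y} {ω | T.M ω = m ∧ T.Z ω = z ∧ T.A ω = x' ∧ T.W ω = w ∧ T.S ω = s''})
    -- exclusion restriction: `P(M=m | Z=z, A=x, W=w, S=s')` does not depend on `x`
    (hMexcl : ∀ (m z x x' s' : Fin 2) (w : 𝒲),
      T.cpr {ω | T.M ω = m} {ω | T.Z ω = z ∧ T.A ω = x ∧ T.W ω = w ∧ T.S ω = s'} =
      T.cpr {ω | T.M ω = m} {ω | T.Z ω = z ∧ T.A ω = x' ∧ T.W ω = w ∧ T.S ω = s'}) :
    ∀ ω : Ω,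
      T.cexp (T.DY gs a)
          {ω' | T.Y ω' = T.Y ω ∧ T.M ω' = T.M ω ∧ T.Z ω' = T.Z ω ∧
                T.W ω' = T.W ω ∧ T.S ω' = T.S ω} -
        T.cexp (T.DY gs a)
          {ω' | T.M ω' = T.M ω ∧ T.Z ω' = T.Z ω ∧ T.W ω' = T.W ω ∧ T.S ω' = T.S ω} =
      T.DYr gs a ω := by
  intro ω
  have := T.isProb
  have mM : ∀ m, MeasurableSet {ω' | T.M ω' = m} := fun m => T.measM (measurableSet_singleton m)
  have mZ : ∀ m, MeasurableSet {ω' | T.Z ω' = m} := fun m => T.measZ (measurableSet_singleton m)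
  have mW : ∀ m, MeasurableSet {ω' | T.W ω' = m} := fun m => T.measW (measurableSet_singleton m)
  have mS : ∀ m, MeasurableSet {ω' | T.S ω' = m} := fun m => T.measS (measurableSet_singleton m)
  have mY : ∀ m, MeasurableSet {ω' | T.Y ω' = m} := fun m => T.measY (measurableSet_singleton m)
  have hy := T.hY ω
  have hq := T.qbarYr_eq hYexcl a (T.M ω) (T.Z ω) (T.W ω)
  unfold TransportSetup.DYr
  generalize T.Y ω = y at *
  generalize T.M ω = m at *
  generalize T.Z ω = z at *
  generalize T.W ω = w at *
  generalize T.S ω = s at *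
  have m2 : MeasurableSet {ω' | T.M ω' = m ∧ T.Z ω' = z ∧ T.W ω' = w ∧ T.S ω' = s} :=
    (mM m).inter ((mZ z).inter ((mW w).inter (mS s)))
  have m1 : MeasurableSet
      {ω' | T.Y ω' = y ∧ T.M ω' = m ∧ T.Z ω' = z ∧ T.W ω' = w ∧ T.S ω' = s} :=
    (mY y).inter m2
  by_cases hs : s = 1
  swap
  · have hz : ∀ ω', T.S ω' = s → T.DY gs a ω' = 0 := by
      intro ω' h
      simp [TransportSetup.DY, TransportSetup.Hwt, h, hs]
    unfold TransportSetup.cexp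
    rw [setIntegral_eq_zero_of_forall_eq_zero fun ω' h => hz ω' h.2.2.2.2,
      setIntegral_eq_zero_of_forall_eq_zero fun ω' h => hz ω' h.2.2.2]
    simp [hs]
  subst hs
  have e2 : {ω' | T.M ω' = m ∧ T.Z ω' = z ∧ T.W ω' = w ∧ T.S ω' = 1} ∩ {ω' | T.A ω' = a} =
      {ω' | T.M ω' = m ∧ T.Z ω' = z ∧ T.A ω' = a ∧ T.W ω' = w ∧ T.S ω' = 1} := by
    ext ω'
    simp only [Set.mem_inter_iff, Set.mem_setOf_eq]
    tauto
  have e1 : {ω' | T.Y ω' = y ∧ T.M ω' = m ∧ T.Z ω' = z ∧ T.W ω' = w ∧ T.S ω' = 1} ∩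
        {ω' | T.A ω' = a} = {ω' | T.Y ω' = y} ∩
      {ω' | T.M ω' = m ∧ T.Z ω' = z ∧ T.A ω' = a ∧ T.W ω' = w ∧ T.S ω' = 1} := by
    ext ω'
    simp only [Set.mem_inter_iff, Set.mem_setOf_eq]
    tauto
  have hmix := T.cpr_mix_A hYexcl a m z 1 w y hy
  have p3 : 0 < T.pr {ω' | T.M ω' = m ∧ T.Z ω' = z ∧ T.A ω' = a ∧ T.W ω' = w ∧ T.S ω' = 1} := by
    refine T.pr_pos _ 1 a z m w fun ω hω => ?_
    simp only [Set.mem_setOf_eq] at hω ⊢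
    tauto
  have p2 : 0 < T.pr {ω' | T.M ω' = m ∧ T.Z ω' = z ∧ T.W ω' = w ∧ T.S ω' = 1} := by
    refine T.pr_pos _ 1 a z m w fun ω hω => ?_
    simp only [Set.mem_setOf_eq] at hω ⊢
    tauto
  have p1 : 0 < T.pr
      {ω' | T.Y ω' = y ∧ T.M ω' = m ∧ T.Z ω' = z ∧ T.W ω' = w ∧ T.S ω' = 1} := by
    refine T.pr_pos_y _ 1 a z m w y hy fun ω hω => ?_
    simp only [Set.mem_setOf_eq] at hω ⊢
    tauto
  have p4 : 0 < T.pr {ω' | T.W ω' = w ∧ T.S ω' = 1} := by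
    refine T.pr_pos _ 1 a z m w fun ω hω => ?_
    simp only [Set.mem_setOf_eq] at hω ⊢
    tauto
  have p5 : 0 < T.pS0 := by
    refine T.pr_pos _ 0 a z m w fun ω hω => ?_
    simp only [Set.mem_setOf_eq] at hω ⊢
    tauto
  have p6 : 0 < T.pSW 1 w := by
    refine div_pos (T.pr_pos _ 1 a z m w fun ω hω => ?_) (T.pr_pos _ 1 a z m w fun ω hω => ?_)
    all_goals
      simp only [Set.mem_inter_iff, Set.mem_setOf_eq] at hω ⊢
      tauto
  have hI2 : ∫ ω' in {ω' | T.M ω' = m ∧ T.Z ω' = z ∧ T.A ω' = a ∧ T.W ω' = w ∧ T.S ω' = 1},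
      T.Y ω' ∂T.P = T.qbarY m z a w *
      T.pr {ω' | T.M ω' = m ∧ T.Z ω' = z ∧ T.A ω' = a ∧ T.W ω' = w ∧ T.S ω' = 1} := by
    unfold TransportSetup.qbarY TransportSetup.cexp
    rw [div_mul_cancel₀ _ p3.ne']
  have mF3 : MeasurableSet ({ω' | T.Y ω' = y} ∩
      {ω' | T.M ω' = m ∧ T.Z ω' = z ∧ T.A ω' = a ∧ T.W ω' = w ∧ T.S ω' = 1}) := by
    rw [← e1]
    exact m1.inter (T.measA (measurableSet_singleton a))
  have hI1 : ∫ ω' in {ω' | T.Y ω' = y} ∩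
      {ω' | T.M ω' = m ∧ T.Z ω' = z ∧ T.A ω' = a ∧ T.W ω' = w ∧ T.S ω' = 1},
      T.Y ω' ∂T.P = y * T.pr ({ω' | T.Y ω' = y} ∩
      {ω' | T.M ω' = m ∧ T.Z ω' = z ∧ T.A ω' = a ∧ T.W ω' = w ∧ T.S ω' = 1}) := by
    rw [setIntegral_congr_fun (g := fun _ => y) mF3 fun ω' h => h.1, setIntegral_const,
      smul_eq_mul, mul_comm]
    rfl
  unfold TransportSetup.cexp
  rw [T.integral_DY gs a m z w _ m1 (fun ω' h => h.2),
    T.integral_DY gs a m z w _ m2 (fun ω' h => h), e1, e2, hI1, hI2, hq, T.denom_a, T.denom_r,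
    sub_self, mul_zero, zero_div, sub_zero, if_pos rfl]
  unfold TransportSetup.cpr at hmix
  rw [← Set.setOf_and] at hmix
  rw [div_eq_div_iff p2.ne' p3.ne'] at hmix
  generalize T.pr {ω' | T.M ω' = m ∧ T.Z ω' = z ∧ T.A ω' = a ∧ T.W ω' = w ∧ T.S ω' = 1} = q3 at *
  generalize T.pr {ω' | T.M ω' = m ∧ T.Z ω' = z ∧ T.W ω' = w ∧ T.S ω' = 1} = q2 at *
  generalize T.pr {ω' | T.Y ω' = y ∧ T.M ω' = m ∧ T.Z ω' = z ∧ T.W ω' = w ∧ T.S ω' = 1} = q1 at *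
  generalize T.pr ({ω' | T.Y ω' = y} ∩
      {ω' | T.M ω' = m ∧ T.Z ω' = z ∧ T.A ω' = a ∧ T.W ω' = w ∧ T.S ω' = 1}) = q0 at *
  have hq0 : q0 = q1 * q3 / q2 := by
    rw [eq_div_iff p2.ne']
    exact hmix.symm
  rw [hq0]
  field_simp
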